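/- arXiv:1110.2928 — 2 statements merged into one kernel-verified Lean document; each statement's English description precedes it below -/
import Mathlib

section
/- Let q be a positive integer and let I ⊆ A be a squarefree monomial ideal with I ⊆ 𝔪_A². Then for every i ≥ 0 there is an isomorphism of k-vector spaces Tor_i^{A/I}(k,k) ≅ Tor_i^{A/I_q}(k,k). -/
open CategoryTheory MvPolynomial

/-- `Tor_i^R(R/J, R/J)` as an object of `ModuleCat R`; for `J` the maximal ideal of a
local `k`-algebra `R` this is `Tor_i^R(k, k)`. -/
noncomputable def TorResidue (R : Type) [CommRing R] (J : Ideal R) (i : ℕ) : ModuleCat R :=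
  ((Tor (ModuleCat R) i).obj (ModuleCat.of R (R ⧸ J))).obj (ModuleCat.of R (R ⧸ J))

/-- `Tor_i^R(R/J, R/J)` regarded as a `k`-vector space via `algebraMap k R`. -/
noncomputable def TorVS (k : Type) [Field k] (R : Type) [CommRing R] [Algebra k R]
    (J : Ideal R) (i : ℕ) : Type :=
  TorResidue R J i

noncomputable instance (k : Type) [Field k] (R : Type) [CommRing R] [Algebra k R]
    (J : Ideal R) (i : ℕ) : AddCommGroup (TorVS k R J i) :=
  inferInstanceAs (AddCommGroup (TorResidue R J i))

noncomputable instance (k : Type) [Field k] (R : Type) [CommRing R] [Algebra k R]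
    (J : Ideal R) (i : ℕ) : Module k (TorVS k R J i) :=
  Module.compHom (TorResidue R J i) (algebraMap k R)

/-- The maximal ideal of `A/I`: the image of `𝔪_A = (x_1, …, x_n)`. -/
noncomputable def resMax (k : Type) [Field k] (n : ℕ) (I : Ideal (MvPolynomial (Fin n) k)) :
    Ideal (MvPolynomial (Fin n) k ⧸ I) :=
  Ideal.map (Ideal.Quotient.mk I) (Ideal.span (Set.range (X : Fin n → MvPolynomial (Fin n) k)))

section DimensionShift

open CategoryTheory.Limits

variable {C D : Type*} [Category* C] [Abelian C] [Category* D] [Abelian D]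

theorem CategoryTheory.ShortComplex.exact_comp_mono {X₁ X₂ X₃ X₄ : C} {f : X₁ ⟶ X₂} {g : X₂ ⟶ X₃}
    {w : f ≫ g = 0} (h : (ShortComplex.mk f g w).Exact) (i : X₃ ⟶ X₄) [Mono i]
    (w' : f ≫ g ≫ i = 0) : (ShortComplex.mk f (g ≫ i) w').Exact := by
  let φ : ShortComplex.mk f g w ⟶ ShortComplex.mk f (g ≫ i) w' :=
    { τ₁ := 𝟙 _
      τ₂ := 𝟙 _
      τ₃ := i }
  have : Mono φ.τ₃ := inferInstanceAs (Mono i)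
  exact (ShortComplex.exact_iff_of_epi_of_isIso_of_mono φ).1 h

theorem CategoryTheory.ShortComplex.exact_epi_comp {X₀ X₁ X₂ X₃ : C} {f : X₁ ⟶ X₂} {g : X₂ ⟶ X₃}
    {w : f ≫ g = 0} (h : (ShortComplex.mk f g w).Exact) (p : X₀ ⟶ X₁) [Epi p]
    (w' : (p ≫ f) ≫ g = 0) : (ShortComplex.mk (p ≫ f) g w').Exact := by
  let φ : ShortComplex.mk (p ≫ f) g w' ⟶ ShortComplex.mk f g w :=
    { τ₁ := p
      τ₂ := 𝟙 _
      τ₃ := 𝟙 _ }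
  have : Epi φ.τ₁ := inferInstanceAs (Epi p)
  exact (ShortComplex.exact_iff_of_epi_of_isIso_of_mono φ).2 h

/-- The homology of `X₁ ⟶ X₂ ⟶ X₄` when the second map factors through a cokernel of the first. -/
noncomputable def CategoryTheory.ShortComplex.homologyIsoKernel {X₁ X₂ X₃ X₄ : C}
    {f : X₁ ⟶ X₂} {p : X₂ ⟶ X₃} [Epi p] {w : f ≫ p = 0} (h : (ShortComplex.mk f p w).Exact)
    (g : X₃ ⟶ X₄) (w' : f ≫ p ≫ g = 0) :
    (ShortComplex.mk f (p ≫ g) w').homology ≅ kernel g := by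
  have hp : IsColimit (CokernelCofork.ofπ p w) := by
    haveI : Epi (ShortComplex.mk f p w).g := inferInstanceAs (Epi p)
    exact h.gIsCokernel
  have hdesc : hp.desc (CokernelCofork.ofπ (p ≫ g) w') = g :=
    (cancel_epi p).1 (hp.fac _ WalkingParallelPair.one)
  let r : (ShortComplex.mk f (p ≫ g) w').RightHomologyData :=
    { Q := X₃
      H := kernel g
      p := p
      ι := kernel.ι _
      wp := w
      hp := hp
      wι := (congrArg (kernel.ι g ≫ ·) hdesc).trans (kernel.condition g)
      hι := KernelFork.IsLimit.ofι' _ _ fun {A} k hk =>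
        ⟨kernel.lift g k ((congrArg (k ≫ ·) hdesc).symm.trans hk), kernel.lift_ι _ _ _⟩ }
  exact r.homologyIso

/-- The augmentation map of a projective resolution. -/
noncomputable def CategoryTheory.ProjectiveResolution.augmentation {X : C}
    (Q : ProjectiveResolution X) : Q.complex.X 0 ⟶ X :=
  Q.π.f 0

theorem CategoryTheory.ProjectiveResolution.d_comp_augmentation {X : C}
    (Q : ProjectiveResolution X) : Q.complex.d 1 0 ≫ Q.augmentation = 0 :=
  Q.complex_d_comp_π_f_zero

theorem CategoryTheory.ProjectiveResolution.exact_augmentation {X : C}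
    (Q : ProjectiveResolution X) : (ShortComplex.mk _ _ Q.d_comp_augmentation).Exact :=
  Q.exact₀

instance {X : C} (Q : ProjectiveResolution X) : Epi Q.augmentation :=
  inferInstanceAs (Epi (Q.π.f 0))

theorem CategoryTheory.ProjectiveResolution.d_comp_augmentation_comp {X Y : C}
    (Q : ProjectiveResolution X) (f : X ⟶ Y) : Q.complex.d 1 0 ≫ Q.augmentation ≫ f = 0 := by
  rw [← Category.assoc, Q.d_comp_augmentation, zero_comp]

/-- Splice a projective resolution of the kernel of an epimorphism from a projective object. -/
noncomputable def CategoryTheory.ProjectiveResolution.splice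
    {S : ShortComplex C} (hS : S.ShortExact) [Projective S.X₂]
    (Q : ProjectiveResolution S.X₁) : ProjectiveResolution S.X₃ where
  complex := ChainComplex.augment Q.complex (Q.augmentation ≫ S.f) (Q.d_comp_augmentation_comp _)
  projective n := by
    cases n with
    | zero => exact inferInstanceAs (Projective S.X₂)
    | succ n => exact inferInstanceAs (Projective (Q.complex.X n))
  π := (ChainComplex.toSingle₀Equiv _ _).symm ⟨S.g, by
    change (Q.augmentation ≫ S.f) ≫ S.g = 0
    rw [Category.assoc, S.zero, comp_zero]⟩
  quasiIso := ⟨fun n => by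
    have := hS.mono_f
    have := hS.epi_g
    match n with
    | 0 =>
      rw [ChainComplex.quasiIsoAt₀_iff, ShortComplex.quasiIso_iff_of_zeros']
      · have w : (Q.augmentation ≫ S.f) ≫ S.g = 0 := by
          rw [Category.assoc, S.zero, comp_zero]
        refine (ShortComplex.exact_and_epi_g_iff_of_iso
          (S₂ := ShortComplex.mk (Q.augmentation ≫ S.f) S.g w) ?_).2
          ⟨ShortComplex.exact_epi_comp hS.exact Q.augmentation w, this⟩
        refine ShortComplex.isoMk (Iso.refl (Q.complex.X 0)) (Iso.refl S.X₂) (Iso.refl S.X₃)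
          ((Category.id_comp _).trans (Category.comp_id _).symm) ?_
        refine (Category.id_comp S.g).trans ?_
        refine Eq.trans ?_ (Category.comp_id _).symm
        exact (ChainComplex.toSingle₀Equiv_symm_apply_f_zero
          (C := ChainComplex.augment Q.complex _ (Q.d_comp_augmentation_comp S.f)) S.g w).symm
      all_goals rfl
    | 1 =>
      rw [quasiIsoAt_iff_exactAt']
      · rw [HomologicalComplex.exactAt_iff' _ 2 1 0 (by simp) (by simp)]
        exact ShortComplex.exact_comp_mono Q.exact_augmentation S.f (Q.d_comp_augmentation_comp _)
      · apply ChainComplex.exactAt_succ_single_obj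
    | n + 2 =>
      rw [quasiIsoAt_iff_exactAt']
      · rw [HomologicalComplex.exactAt_iff' _ (n + 3) (n + 2) (n + 1) (by simp) (by simp)]
        exact Q.exact_succ n
      · apply ChainComplex.exactAt_succ_single_obj⟩

variable [EnoughProjectives C] (F : C ⥤ D) [F.Additive]
  {S : ShortComplex C} (hS : S.ShortExact) [Projective S.X₂]

include hS in
theorem CategoryTheory.Functor.nonempty_leftDerived_shift (i : ℕ) :
    Nonempty ((F.leftDerived (i + 2)).obj S.X₃ ≅ (F.leftDerived (i + 1)).obj S.X₁) := by
  let Q := projectiveResolution S.X₁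
  let K := (F.mapHomologicalComplex (ComplexShape.down ℕ)).obj (Q.splice hS).complex
  let L := (F.mapHomologicalComplex (ComplexShape.down ℕ)).obj Q.complex
  have e₁ := ShortComplex.homologyMapIso
    (K.isoSc' (i + 3) (i + 2) (i + 1) (by simp) (by simp))
  have e₂ := ShortComplex.homologyMapIso (L.isoSc' (i + 2) (i + 1) i (by simp) (by simp))
  exact ⟨(Q.splice hS).isoLeftDerivedObj F (i + 2) ≪≫ e₁ ≪≫ e₂.symm ≪≫
    (Q.isoLeftDerivedObj F (i + 1)).symm⟩

include hS in
theorem CategoryTheory.Functor.nonempty_leftDerived_one_iso_kernel [PreservesFiniteColimits F] :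
    Nonempty ((F.leftDerived 1).obj S.X₃ ≅ Limits.kernel (F.map S.f)) := by
  let Q := projectiveResolution S.X₁
  let K := (F.mapHomologicalComplex (ComplexShape.down ℕ)).obj (Q.splice hS).complex
  have e₁ := ShortComplex.homologyMapIso (K.isoSc' 2 1 0 (by simp) (by simp))
  have hF : ∀ T : ShortComplex C, T.Exact ∧ Epi T.g → (T.map F).Exact ∧ Epi (F.map T.g) :=
    ((Functor.preservesFiniteColimits_tfae F).out 3 1).1 ‹PreservesFiniteColimits F›
  have hex : (ShortComplex.mk (F.map (Q.complex.d 1 0)) (F.map Q.augmentation)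
      (by rw [← F.map_comp, Q.d_comp_augmentation, F.map_zero])).Exact :=
    (hF _ ⟨Q.exact_augmentation, inferInstanceAs (Epi Q.augmentation)⟩).1
  have w : F.map (Q.complex.d 1 0) ≫ F.map Q.augmentation ≫ F.map S.f = 0 := by
    rw [← F.map_comp, ← F.map_comp, Q.d_comp_augmentation_comp, F.map_zero]
  have e₂ : K.sc' 2 1 0 ≅
      ShortComplex.mk (F.map (Q.complex.d 1 0)) (F.map Q.augmentation ≫ F.map S.f) w :=
    ShortComplex.isoMk (Iso.refl _) (Iso.refl _) (Iso.refl _)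
      ((Category.id_comp _).trans (Category.comp_id _).symm)
      ((Category.id_comp _).trans ((F.map_comp _ _).symm.trans (Category.comp_id _).symm))
  exact ⟨(Q.splice hS).isoLeftDerivedObj F 1 ≪≫ e₁ ≪≫ ShortComplex.homologyMapIso e₂ ≪≫
    ShortComplex.homologyIsoKernel hex _ w⟩

end DimensionShift

instance CategoryTheory.Functor.leftDerived_additive {C D : Type*} [Category* C] [Abelian C]
    [Category* D] [Abelian D] [HasProjectiveResolutions C] (F : C ⥤ D) [F.Additive] (n : ℕ) :
    (F.leftDerived n).Additive where
  map_add {X Y f g} := by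
    let P := projectiveResolution X
    let Q := projectiveResolution Y
    have hf := F.leftDerived_map_eq n f (ProjectiveResolution.lift f P Q)
      (ProjectiveResolution.lift_commutes f P Q)
    have hg := F.leftDerived_map_eq n g (ProjectiveResolution.lift g P Q)
      (ProjectiveResolution.lift_commutes g P Q)
    have hfg := F.leftDerived_map_eq n (f + g)
      (ProjectiveResolution.lift f P Q + ProjectiveResolution.lift g P Q) (by
        rw [Preadditive.add_comp, ProjectiveResolution.lift_commutes,
          ProjectiveResolution.lift_commutes, Functor.map_add, Preadditive.comp_add])
    rw [hf, hg, hfg, Functor.map_add, Preadditive.add_comp, Preadditive.comp_add]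

section Length

/-- The length over `k` of a module over a `k`-algebra. -/
noncomputable def lengthOver (k R X : Type) [Field k] [CommRing R] [Algebra k R] [AddCommGroup X]
    [Module R X] : ℕ∞ :=
  letI := Module.compHom X (algebraMap k R)
  Module.length k X

variable (k : Type) [Field k] {R S : Type} [CommRing R] [Algebra k R] [CommRing S] [Algebra k S]
  {X Y Z : Type} [AddCommGroup X] [Module R X] [AddCommGroup Y] [Module R Y]
  [AddCommGroup Z] [Module R Z]

theorem lengthOver_eq_length [Module k X] [IsScalarTower k R X] :
    lengthOver k R X = Module.length k X := by
  have : (Module.compHom X (algebraMap k R) : Module k X) = ‹Module k X› :=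
    Module.ext' _ _ fun c x => algebraMap_smul R c x
  rw [lengthOver, this]

theorem lengthOver_ne_top_of_finite [Module.Finite k R] [Module.Finite R X] :
    lengthOver k R X ≠ ⊤ := by
  let _ : Module k X := Module.compHom X (algebraMap k R)
  have : IsScalarTower k R X := .of_algebraMap_smul fun _ _ => rfl
  have : Module.Finite k X := .trans R X
  rw [lengthOver_eq_length k]
  exact Module.length_ne_top

theorem lengthOver_congr_semilinear {W : Type} [AddCommGroup W] [Module S W] (f : R →ₐ[k] S)
    (g : X →ₛₗ[(f : R →+* S)] W)
    (hg : Function.Bijective g) : lengthOver k R X = lengthOver k S W := by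
  let _ : Module k X := Module.compHom X (algebraMap k R)
  have : IsScalarTower k R X := .of_algebraMap_smul fun _ _ => rfl
  let _ : Module k W := Module.compHom W (algebraMap k S)
  have : IsScalarTower k S W := .of_algebraMap_smul fun _ _ => rfl
  rw [lengthOver_eq_length k, lengthOver_eq_length k]
  let g' : X →ₗ[k] W :=
    { toFun := g
      map_add' := g.map_add
      map_smul' := fun c x => by
        rw [← algebraMap_smul R c x, g.map_smulₛₗ]
        simp }
  exact (LinearEquiv.ofBijective g' hg).length_eq

theorem lengthOver_congr (e : X ≃ₗ[R] Y) : lengthOver k R X = lengthOver k R Y :=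
  lengthOver_congr_semilinear k (AlgHom.id k R) (e : X →ₗ[R] Y) e.bijective

theorem lengthOver_exact (f : X →ₗ[R] Y) (g : Y →ₗ[R] Z) (hf : Function.Injective f)
    (hg : Function.Surjective g) (h : Function.Exact f g) :
    lengthOver k R Y = lengthOver k R X + lengthOver k R Z := by
  let _ : Module k X := Module.compHom X (algebraMap k R)
  have : IsScalarTower k R X := .of_algebraMap_smul fun _ _ => rfl
  let _ : Module k Y := Module.compHom Y (algebraMap k R)
  have : IsScalarTower k R Y := .of_algebraMap_smul fun _ _ => rfl
  let _ : Module k Z := Module.compHom Z (algebraMap k R)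
  have : IsScalarTower k R Z := .of_algebraMap_smul fun _ _ => rfl
  exact Module.length_eq_add_of_exact (R := k) (f.restrictScalars k) (g.restrictScalars k) hf hg h

theorem lengthOver_prod : lengthOver k R (X × Y) = lengthOver k R X + lengthOver k R Y :=
  lengthOver_exact k (LinearMap.inl R X Y) (LinearMap.snd R X Y) LinearMap.inl_injective
    LinearMap.snd_surjective .inl_snd

theorem lengthOver_ker_add (f : X →ₗ[R] Y) (g : Y →ₗ[R] Z) (hg : Function.Surjective g)
    (h : Function.Exact f g) :
    lengthOver k R f.ker + lengthOver k R Y = lengthOver k R X + lengthOver k R Z := by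
  have h₁ := lengthOver_exact k f.ker.subtype f.rangeRestrict f.ker.injective_subtype
    f.surjective_rangeRestrict (by
      rw [LinearMap.exact_iff, LinearMap.ker_rangeRestrict, Submodule.range_subtype])
  have h₂ := lengthOver_exact k f.range.subtype g f.range.injective_subtype hg (by
    rw [LinearMap.exact_iff, Submodule.range_subtype, LinearMap.exact_iff.1 h])
  rw [h₁, h₂, add_assoc]

end Length

section TorLength

variable (k : Type) [Field k] {R : Type} [CommRing R] [Algebra k R] (J : Ideal R)
  (M N K P : Type) [AddCommGroup M] [Module R M] [AddCommGroup N] [Module R N]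
  [AddCommGroup K] [Module R K] [AddCommGroup P] [Module R P]

/-- The functor `R/J ⊗ -`. -/
noncomputable abbrev resTensor {R : Type} [CommRing R] (J : Ideal R) : ModuleCat R ⥤ ModuleCat R :=
  (MonoidalCategory.tensoringLeft (ModuleCat R)).obj (ModuleCat.of R (R ⧸ J))

/-- The length over `k` of `Tor_i^R(R/J, M)`. -/
noncomputable def torLength (i : ℕ) : ℕ∞ :=
  lengthOver k R (((Tor (ModuleCat R) i).obj (ModuleCat.of R (R ⧸ J))).obj (ModuleCat.of R M))

variable {M N K P}

theorem torLength_zero : torLength k J M 0 = lengthOver k R (M ⧸ (J • ⊤ : Submodule R M)) := by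
  have e₁ : ((resTensor J).leftDerived 0).obj (ModuleCat.of R M) ≅
      (resTensor J).obj (ModuleCat.of R M) := (resTensor J).leftDerivedZeroIsoSelf.app _
  exact lengthOver_congr k (e₁.toLinearEquiv.trans (TensorProduct.quotTensorEquivQuotSMul M J))

theorem torLength_prod (i : ℕ) :
    torLength k J (M × N) i = torLength k J M i + torLength k J N i := by
  let F := (Tor (ModuleCat R) i).obj (ModuleCat.of R (R ⧸ J))
  have : F.Additive := inferInstanceAs ((resTensor J).leftDerived i).Additive
  have : Limits.PreservesBinaryBiproducts F :=
    Limits.preservesBinaryBiproducts_of_preservesBiproducts F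
  have e : F.obj (ModuleCat.of R (M × N)) ≅
      ModuleCat.of R (F.obj (ModuleCat.of R M) × F.obj (ModuleCat.of R N)) :=
    F.mapIso (ModuleCat.biprodIsoProd (.of R M) (.of R N)).symm ≪≫ F.mapBiprod _ _ ≪≫
      ModuleCat.biprodIsoProd _ _
  exact (lengthOver_congr k e.toLinearEquiv).trans (lengthOver_prod k)

variable (f : K →ₗ[R] P) (g : P →ₗ[R] M) (hf : Function.Injective f)
  (hg : Function.Surjective g) (h : Function.Exact f g)

include hf hg h in
theorem torLength_succ_succ [Module.Projective R P] (i : ℕ) :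
    torLength k J M (i + 2) = torLength k J K (i + 1) := by
  have hS := ModuleCat.shortComplex_shortExact
    (ModuleCat.shortComplexOfCompEqZero f g h.linearMap_comp_eq_zero) h hf hg
  have : Projective (ModuleCat.shortComplexOfCompEqZero f g h.linearMap_comp_eq_zero).X₂ :=
    (IsProjective.iff_projective (R := R) P).1 inferInstance
  obtain ⟨e⟩ := (resTensor J).nonempty_leftDerived_shift hS i
  exact lengthOver_congr k e.toLinearEquiv

include hf hg h in
theorem torLength_one_add [Module.Projective R P] :
    torLength k J M 1 + torLength k J P 0 = torLength k J K 0 + torLength k J M 0 := by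
  have hS := ModuleCat.shortComplex_shortExact
    (ModuleCat.shortComplexOfCompEqZero f g h.linearMap_comp_eq_zero) h hf hg
  have : Projective (ModuleCat.shortComplexOfCompEqZero f g h.linearMap_comp_eq_zero).X₂ :=
    (IsProjective.iff_projective (R := R) P).1 inferInstance
  obtain ⟨e⟩ := (resTensor J).nonempty_leftDerived_one_iso_kernel hS
  have e' : ((resTensor J).leftDerived 1).obj (ModuleCat.of R M) ≅
      ModuleCat.of R (f.lTensor (R ⧸ J)).ker :=
    e ≪≫ ModuleCat.kernelIsoKer (ModuleCat.ofHom (f.lTensor (R ⧸ J)))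
  have key := lengthOver_ker_add k (f.lTensor (R ⧸ J)) (g.lTensor (R ⧸ J))
    (LinearMap.lTensor_surjective _ hg) (lTensor_exact _ h hg)
  have h0 : ∀ (X : Type) [AddCommGroup X] [Module R X],
      torLength k J X 0 = lengthOver k R (TensorProduct R (R ⧸ J) X) := fun X _ _ =>
    (torLength_zero k J).trans (lengthOver_congr k (TensorProduct.quotTensorEquivQuotSMul X J)).symm
  have h1 : torLength k J M 1 = lengthOver k R (f.lTensor (R ⧸ J)).ker :=
    lengthOver_congr k e'.toLinearEquiv
  rw [h0, h0, h0, h1]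
  exact key

end TorLength

section Finiteness

variable (k : Type) [Field k] {R : Type} [CommRing R] [Algebra k R] (J : Ideal R)
  (M : Type) [AddCommGroup M] [Module R M] [Module.Finite R M] [Module.Finite k (R ⧸ J)]

theorem torLength_zero_ne_top : torLength k J M 0 ≠ ⊤ := by
  rw [torLength_zero]
  have : Module.Finite (R ⧸ J) (M ⧸ (J • ⊤ : Submodule R M)) := .of_restrictScalars_finite R _ _
  let g : (M ⧸ (J • ⊤ : Submodule R M)) →ₛₗ[(Ideal.Quotient.mkₐ k J : R →+* R ⧸ J)]
      (M ⧸ (J • ⊤ : Submodule R M)) :=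
    { toFun := id
      map_add' := fun _ _ => rfl
      map_smul' := fun r x => (algebraMap_smul (R ⧸ J) r x).symm }
  rw [lengthOver_congr_semilinear k (Ideal.Quotient.mkₐ k J) g Function.bijective_id]
  exact lengthOver_ne_top_of_finite k

theorem torLength_ne_top [IsNoetherianRing R] (i : ℕ) : torLength k J M i ≠ ⊤ := by
  induction i generalizing M with
  | zero => exact torLength_zero_ne_top k J M
  | succ i ih =>
    obtain ⟨n, g, hg⟩ := Module.Finite.exists_fin' R M
    cases i with
    | zero =>
      have h := torLength_one_add k J g.ker.subtype g g.ker.injective_subtype hg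
        (LinearMap.exact_subtype_ker_map g)
      intro htop
      rw [zero_add] at htop
      rw [htop, top_add, eq_comm, ENat.add_eq_top] at h
      exact h.elim (torLength_zero_ne_top k J _) (torLength_zero_ne_top k J _)
    | succ i =>
      rw [torLength_succ_succ k J g.ker.subtype g g.ker.injective_subtype hg
        (LinearMap.exact_subtype_ker_map g)]
      exact ih _

end Finiteness

section ChangeOfRings

variable {k : Type} [Field k] {B S : Type} [CommRing B] [Algebra k B] [CommRing S] [Algebra k S]
  {f : B →ₐ[k] S} (hf : Function.Surjective f) {J : Ideal B} {J' : Ideal S}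
  (hJ : J.map (f : B →+* S) = J')
  {M M' : Type} [AddCommGroup M] [Module B M] [AddCommGroup M'] [Module S M']

include hf hJ

theorem torLength_zero_eq_of_semilinear (g : M →ₛₗ[(f : B →+* S)] M')
    (hg : Function.Surjective g) (hker : ∀ m, g m = 0 → m ∈ (J • ⊤ : Submodule B M)) :
    torLength k J M 0 = torLength k J' M' 0 := by
  have : RingHomSurjective (f : B →+* S) := ⟨hf⟩
  rw [torLength_zero, torLength_zero]
  have h₁ : (J • ⊤ : Submodule B M) ≤ (J' • ⊤ : Submodule S M').comap g := by
    refine Submodule.smul_le.2 fun r hr m _ => ?_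
    rw [Submodule.mem_comap, g.map_smulₛₗ]
    exact Submodule.smul_mem_smul (hJ ▸ Ideal.mem_map_of_mem _ hr) trivial
  have h₂ : (J' • ⊤ : Submodule S M') ≤ (J • ⊤ : Submodule B M).map g := by
    refine Submodule.smul_le.2 fun r hr m _ => ?_
    rw [← hJ] at hr
    obtain ⟨b, hb, rfl⟩ := (Ideal.mem_map_iff_of_surjective (f : B →+* S) hf).1 hr
    obtain ⟨m, rfl⟩ := hg m
    exact ⟨b • m, Submodule.smul_mem_smul hb trivial, g.map_smulₛₗ b m⟩
  refine lengthOver_congr_semilinear k f (Submodule.mapQ _ _ g h₁) ⟨?_, ?_⟩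
  · rw [injective_iff_map_eq_zero]
    intro x hx
    obtain ⟨m, rfl⟩ := Submodule.mkQ_surjective _ x
    rw [Submodule.mkQ_apply, Submodule.mapQ_apply, Submodule.Quotient.mk_eq_zero] at hx
    obtain ⟨m₀, hm₀, h⟩ := h₂ hx
    rw [Submodule.mkQ_apply, Submodule.Quotient.mk_eq_zero, ← sub_add_cancel m m₀]
    exact add_mem (hker _ (by rw [map_sub, h, sub_self])) hm₀
  · intro y
    obtain ⟨m, rfl⟩ := Submodule.mkQ_surjective _ y
    obtain ⟨m, rfl⟩ := hg m
    exact ⟨Submodule.Quotient.mk m, rfl⟩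

theorem torLength_eq_of_semilinear [IsNoetherianRing B] [Module.Finite k (B ⧸ J)]
    [Module.Finite B M] {z : B} (hz : z ∈ J)
    (hzB : ∀ b, z * b = 0 → b = 0) (hfz : ∀ b, f b = 0 ↔ z ∣ b)
    (hzM : ∀ m : M, z • m = 0 → m = 0) (g : M →ₛₗ[(f : B →+* S)] M')
    (hg : Function.Surjective g) (hker : ∀ m, g m = 0 → ∃ m', z • m' = m) (i : ℕ) :
    torLength k J M i = torLength k J' M' i := by
  induction i generalizing M M' with
  | zero =>
    refine torLength_zero_eq_of_semilinear hf hJ g hg fun m hm => ?_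
    obtain ⟨m', rfl⟩ := hker m hm
    exact Submodule.smul_mem_smul hz trivial
  | succ i ih =>
    obtain ⟨n, w, hw⟩ := Module.Finite.exists_fin (R := B) (M := M)
    let p := Fintype.linearCombination B w
    have hp : Function.Surjective p := by
      rw [← LinearMap.range_eq_top, Fintype.range_linearCombination, hw]
    let p' := Fintype.linearCombination S (g ∘ w)
    let gP : (Fin n → B) →ₛₗ[(f : B →+* S)] (Fin n → S) :=
      { toFun := fun v j => f (v j)
        map_add' := fun u v => funext fun j => map_add f _ _
        map_smul' := fun u v => funext fun j => map_mul f _ _ }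
    have hgP : Function.Surjective gP := fun v =>
      ⟨fun j => (hf (v j)).choose, funext fun j => (hf (v j)).choose_spec⟩
    have hgPker : ∀ v, gP v = 0 → ∃ v', z • v' = v := fun v hv =>
      ⟨fun j => ((hfz (v j)).1 (congrFun hv j)).choose,
        funext fun j => ((hfz (v j)).1 (congrFun hv j)).choose_spec.symm⟩
    have hcomp : ∀ v, p' (gP v) = g (p v) := fun v => by
      simp [p, p', gP, Fintype.linearCombination_apply]
    have hp' : Function.Surjective p' := fun m' => by
      obtain ⟨m, rfl⟩ := hg m'
      obtain ⟨v, rfl⟩ := hp m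
      exact ⟨_, hcomp v⟩
    have hgPz : ∀ v, gP (z • v) = 0 := fun v =>
      funext fun j => (hfz _).2 (dvd_mul_right z (v j))
    let gK : p.ker →ₛₗ[(f : B →+* S)] p'.ker :=
      { toFun := fun v => ⟨gP v, by
          rw [LinearMap.mem_ker, hcomp, LinearMap.mem_ker.1 v.2, map_zero]⟩
        map_add' := fun u v => Subtype.ext (gP.map_add u v)
        map_smul' := fun c v => Subtype.ext (gP.map_smulₛₗ c v) }
    have hzP : ∀ v : Fin n → B, z • v = 0 → v = 0 := fun v hv =>
      funext fun j => hzB _ (congrFun hv j)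
    have hgK : Function.Surjective gK := by
      rintro ⟨v', hv'⟩
      obtain ⟨v, rfl⟩ := hgP v'
      rw [LinearMap.mem_ker, hcomp] at hv'
      obtain ⟨m, hm⟩ := hker _ hv'
      obtain ⟨u, rfl⟩ := hp m
      refine ⟨⟨v - z • u, ?_⟩, Subtype.ext ?_⟩
      · rw [LinearMap.mem_ker, map_sub, map_smul, hm, sub_self]
      · exact (map_sub gP _ _).trans (by rw [hgPz, sub_zero])
    have hgKker : ∀ v, gK v = 0 → ∃ v', z • v' = v := by
      rintro ⟨v, hv⟩ h
      obtain ⟨u, rfl⟩ := hgPker v (congrArg Subtype.val h)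
      rw [LinearMap.mem_ker, map_smul] at hv
      exact ⟨⟨u, hzM _ hv⟩, rfl⟩
    have hzK : ∀ v : p.ker, z • v = 0 → v = 0 := fun v hv =>
      Subtype.ext (hzP v (congrArg Subtype.val hv))
    have hex := LinearMap.exact_subtype_ker_map p
    have hex' := LinearMap.exact_subtype_ker_map p'
    cases i with
    | zero =>
      have h := torLength_one_add k J _ _ p.ker.injective_subtype hp hex
      rw [ih hzM g hg hker, ih hzP gP hgP hgPker, ih hzK gK hgK hgKker,
        ← torLength_one_add k J' _ _ p'.ker.injective_subtype hp' hex'] at h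
      refine (ENat.add_left_injective_of_ne_top ?_) h
      rw [← ih hzP gP hgP hgPker]
      exact torLength_zero_ne_top k J _
    | succ i =>
      rw [torLength_succ_succ k J _ _ p.ker.injective_subtype hp hex,
        torLength_succ_succ k J' _ _ p'.ker.injective_subtype hp' hex', ih hzK gK hgK hgKker]

end ChangeOfRings

section Nagata

variable (k : Type) [Field k] {B : Type} [CommRing B] [Algebra k B]
  (J : Ideal B) [Module.Finite k (B ⧸ J)]

theorem torLength_quotient_succ (i : ℕ) : torLength k J (B ⧸ J) (i + 1) = torLength k J J i := by
  have hex : Function.Exact J.subtype J.mkQ := LinearMap.exact_subtype_mkQ J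
  cases i with
  | zero =>
    have h := torLength_one_add k J _ _ J.injective_subtype J.mkQ_surjective hex
    have h₀ : torLength k J B 0 = torLength k J (B ⧸ J) 0 :=
      torLength_zero_eq_of_semilinear (f := AlgHom.id k B) Function.surjective_id
        (Ideal.map_id J) J.mkQ J.mkQ_surjective fun b hb => by
          rw [smul_eq_mul, Ideal.mul_top]
          exact (Submodule.Quotient.mk_eq_zero J).1 hb
    rw [h₀] at h
    exact ENat.add_left_injective_of_ne_top (torLength_zero_ne_top k J _) h
  | succ i => exact torLength_succ_succ k J _ _ J.injective_subtype J.mkQ_surjective hex i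

variable {k J} {S : Type} [CommRing S] [Algebra k S]
  {f : B →ₐ[k] S} (hf : Function.Surjective f) {J' : Ideal S}
  (hJ : J.map (f : B →+* S) = J') {z : B} (hz : z ∈ J)
  (hzB : ∀ b, z * b = 0 → b = 0) (hfz : ∀ b, f b = 0 ↔ z ∣ b)

include hf hJ hz hfz

omit [Module.Finite k (B ⧸ J)] in
theorem mem_of_map_mem_map {b : B} (hb : f b ∈ J') : b ∈ J := by
  rw [← hJ] at hb
  obtain ⟨j, hj, h⟩ := (Ideal.mem_map_iff_of_surjective (f : B →+* S) hf).1 hb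
  have hd : z ∣ b - j := (hfz _).1 ((map_sub f b j).trans (sub_eq_zero.2 h.symm))
  rw [← sub_add_cancel b j]
  exact add_mem (J.mem_of_dvd hd hz) hj

omit [Module.Finite k (B ⧸ J)] in
theorem torLength_residue_zero_eq :
    torLength k J (B ⧸ J) 0 = torLength k J' (S ⧸ J') 0 := by
  have hle : J ≤ Submodule.comap (f : B →+* S).toSemilinearMap J' := fun b hb =>
    hJ ▸ Ideal.mem_map_of_mem _ hb
  refine torLength_zero_eq_of_semilinear hf hJ
    (Submodule.mapQ J J' (f : B →+* S).toSemilinearMap hle) (fun y => ?_) fun x hx => ?_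
  · obtain ⟨y, rfl⟩ := Submodule.mkQ_surjective _ y
    obtain ⟨b, rfl⟩ := hf y
    exact ⟨Submodule.Quotient.mk b, rfl⟩
  · obtain ⟨b, rfl⟩ := Submodule.mkQ_surjective _ x
    have hb : f b ∈ J' := (Submodule.Quotient.mk_eq_zero J').1 hx
    rw [Submodule.mkQ_apply, (Submodule.Quotient.mk_eq_zero J).2
      (mem_of_map_mem_map hf hJ hz hfz hb)]
    exact zero_mem _

include hzB

theorem torLength_residue_succ [IsNoetherianRing B] (l : J →ₛₗ[(f : B →+* S)] (S ⧸ J'))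
    (hl : l ⟨z, hz⟩ = 1) (i : ℕ) :
    torLength k J (B ⧸ J) (i + 1) =
      torLength k J' (S ⧸ J') i + torLength k J' (S ⧸ J') (i + 1) := by
  have hfJ : ∀ b : J, f b ∈ J' := fun b => hJ ▸ Ideal.mem_map_of_mem _ b.2
  have hlz : ∀ c, l ⟨c * z, J.mul_mem_left c hz⟩ = Ideal.Quotient.mk J' (f c) := fun c => by
    have h := l.map_smulₛₗ c ⟨z, hz⟩
    rw [hl] at h
    exact h.trans ((Algebra.algebraMap_eq_smul_one (f c)).symm)
  let g : J →ₛₗ[(f : B →+* S)] (S ⧸ J') × J' :=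
    { toFun := fun b => (l b, ⟨f b, hfJ b⟩)
      map_add' := fun b c => Prod.ext (l.map_add b c) (Subtype.ext (map_add f _ _))
      map_smul' := fun b c => Prod.ext (l.map_smulₛₗ b c) (Subtype.ext (map_mul f _ _)) }
  have hg : Function.Surjective g := by
    rintro ⟨s, ⟨j, hj⟩⟩
    have hj' := hj
    rw [← hJ] at hj'
    obtain ⟨b, hb, rfl⟩ := (Ideal.mem_map_iff_of_surjective (f : B →+* S) hf).1 hj'
    obtain ⟨t, ht⟩ := Ideal.Quotient.mk_surjective (s - l ⟨b, hb⟩)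
    obtain ⟨c, rfl⟩ := hf t
    refine ⟨⟨b, hb⟩ + ⟨c * z, J.mul_mem_left c hz⟩, Prod.ext ?_ (Subtype.ext ?_)⟩
    · exact (l.map_add _ _).trans (by rw [hlz, ht, add_sub_cancel])
    · have : f (c * z) = 0 := (hfz _).2 (dvd_mul_left z c)
      exact (map_add f b (c * z)).trans (by rw [this, add_zero]; rfl)
  have hker : ∀ b, g b = 0 → ∃ c, z • c = b := by
    rintro ⟨b, hb⟩ h
    obtain ⟨c, rfl⟩ := (hfz b).1 (congrArg (fun x => (x.2 : S)) h)
    have hc : l ⟨z * c, hb⟩ = 0 := congrArg Prod.fst h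
    simp only [mul_comm z c, hlz] at hc
    exact ⟨⟨c, mem_of_map_mem_map hf hJ hz hfz (Ideal.Quotient.eq_zero_iff_mem.1 hc)⟩, rfl⟩
  have : Module.Finite k (S ⧸ J') := by
    have hle : J ≤ J'.comap f := fun b hb => hfJ ⟨b, hb⟩
    refine Module.Finite.of_surjective (Ideal.quotientMapₐ J' f hle).toLinearMap fun y => ?_
    obtain ⟨y, rfl⟩ := Ideal.Quotient.mk_surjective y
    obtain ⟨b, rfl⟩ := hf y
    exact ⟨Ideal.Quotient.mk J b, rfl⟩
  rw [torLength_quotient_succ, torLength_eq_of_semilinear hf hJ hz hzB hfz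
    (fun b hb => Subtype.ext (hzB _ (congrArg Subtype.val hb))) g hg hker, torLength_prod,
    torLength_quotient_succ]

end Nagata

section Comparison

variable {k : Type} [Field k] {B R S : Type} [CommRing B] [Algebra k B] [CommRing R] [Algebra k R]
  [CommRing S] [Algebra k S]

/-- A surjection onto a quotient by a regular element `z` of `J` which is part of a minimal system
of generators of `J`, as witnessed by a functional on `J` that takes the value `1` at `z`. -/
structure IsNagataQuotient (f : B →ₐ[k] S) (J : Ideal B) (J' : Ideal S) (z : B) : Prop where
  surjective : Function.Surjective f
  map_eq : J.map (f : B →+* S) = J'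
  mem : z ∈ J
  regular : ∀ b, z * b = 0 → b = 0
  apply_eq_zero_iff : ∀ b, f b = 0 ↔ z ∣ b
  exists_functional : ∃ l : J →ₛₗ[(f : B →+* S)] (S ⧸ J'), l ⟨z, mem⟩ = 1

theorem torLength_residue_eq [IsNoetherianRing B] {J : Ideal B} [Module.Finite k (B ⧸ J)]
    {f : B →ₐ[k] R} {g : B →ₐ[k] S} {J₁ : Ideal R} {J₂ : Ideal S} {y z : B}
    (hf : IsNagataQuotient f J J₁ y) (hg : IsNagataQuotient g J J₂ z) (i : ℕ) :
    torLength k J₁ (R ⧸ J₁) i = torLength k J₂ (S ⧸ J₂) i := by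
  obtain ⟨hf, hf₁, hy, hyB, hfy, l, hl⟩ := hf
  obtain ⟨hg, hg₂, hz, hzB, hgz, l', hl'⟩ := hg
  have hne : ∀ i, torLength k J (B ⧸ J) i ≠ ⊤ := torLength_ne_top k J _
  induction i with
  | zero => rw [← torLength_residue_zero_eq hf hf₁ hy hfy, torLength_residue_zero_eq hg hg₂ hz hgz]
  | succ i ih =>
    have h₁ := torLength_residue_succ hf hf₁ hy hyB hfy l hl i
    have h₂ := torLength_residue_succ hg hg₂ hz hzB hgz l' hl' i
    have hne := hne (i + 1)
    rw [h₁, Ne, ENat.add_eq_top, not_or] at hne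
    rw [h₁, ← ih] at h₂
    exact ENat.add_right_injective_of_ne_top hne.1 h₂

end Comparison

section DualNumber

open TrivSqZeroExt

variable {k : Type} [Field k] {B S : Type} [CommRing B] [Algebra k B] [CommRing S] [Algebra k S]

/-- The functional required of an `IsNagataQuotient` may be read off from an algebra map to the
dual numbers. -/
theorem IsNagataQuotient.of_dualNumber {f : B →ₐ[k] S} (hf : Function.Surjective f)
    (e : B →ₐ[k] k) (e' : S →ₐ[k] k) (he : e'.comp f = e) (d : B →ₐ[k] DualNumber k)
    (hd : (fstHom k k k).comp d = e) {z : B} (hz : d z = DualNumber.eps)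
    (hreg : ∀ b, z * b = 0 → b = 0) (hker : ∀ b, f b = 0 ↔ z ∣ b) :
    IsNagataQuotient f (RingHom.ker e) (RingHom.ker e') z := by
  have hfst : ∀ b, (d b).fst = e b := fun b => DFunLike.congr_fun hd b
  have he' : ∀ b, e' (f b) = e b := fun b => DFunLike.congr_fun he b
  have hmap : (RingHom.ker e).map (f : B →+* S) = RingHom.ker e' := by
    have : RingHom.ker e = (RingHom.ker e').comap (f : B →+* S) := by
      ext b
      rw [Ideal.mem_comap, RingHom.mem_ker, RingHom.mem_ker]
      exact Eq.congr_left (he' b).symm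
    rw [this]
    exact Ideal.map_comap_of_surjective (f : B →+* S) hf _
  have hmem : z ∈ RingHom.ker e := by
    rw [RingHom.mem_ker, ← hfst, hz]
    exact DualNumber.fst_eps
  refine ⟨hf, hmap, hmem, hreg, hker, ?_⟩
  let l : RingHom.ker e →ₛₗ[(f : B →+* S)] (S ⧸ RingHom.ker e') :=
    { toFun := fun b => algebraMap k _ (d b).snd
      map_add' := fun a b => by simp
      map_smul' := fun a b => by
        have hb : (d b).fst = 0 := (hfst b).trans b.2
        have h : (Ideal.Quotient.mk (RingHom.ker e')) (f a) = algebraMap k _ (e a) := by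
          rw [← Ideal.Quotient.mk_algebraMap, Ideal.Quotient.mk_eq_mk_iff_sub_mem, RingHom.mem_ker,
            map_sub, he', AlgHom.commutes]
          exact sub_self _
        have h' : (d (a * b)).snd = e a * (d b).snd := by
          rw [map_mul, snd_mul, hb, hfst]
          simp
        rw [Algebra.smul_def, Ideal.Quotient.algebraMap_eq]
        exact (congrArg _ h').trans ((map_mul _ _ _).trans (congrArg (· * _) h.symm)) }
  refine ⟨l, ?_⟩
  change algebraMap k _ (d z).snd = 1
  rw [hz, DualNumber.snd_eps, map_one]

end DualNumber

section PolynomialQuotient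

variable {k : Type} [Field k] {n : ℕ} {R S T : Type} [CommRing R] [Algebra k R] [CommRing S]
  [Algebra k S] [CommRing T] [Algebra k T]

theorem ker_le_ker_aeval {p : MvPolynomial (Fin n) k →ₐ[k] R}
    (hp₂ : RingHom.ker p ≤ idealOfVars (Fin n) k ^ 2) (v : Fin n → T) (hv : ∀ i j, v i * v j = 0) :
    RingHom.ker p ≤ RingHom.ker (aeval v : MvPolynomial (Fin n) k →ₐ[k] T) := by
  refine hp₂.trans ?_
  rw [pow_two, idealOfVars, Ideal.span_mul_span', Ideal.span_le]
  rintro _ ⟨_, ⟨i, rfl⟩, _, ⟨j, rfl⟩, rfl⟩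
  simp [hv]

theorem ker_aeval_zero :
    RingHom.ker (aeval (0 : Fin n → k) : MvPolynomial (Fin n) k →ₐ[k] k) =
      idealOfVars (Fin n) k := by
  ext p
  rw [← pow_one (idealOfVars (Fin n) k), mem_pow_idealOfVars_iff', RingHom.mem_ker, aeval_zero]
  simp [Finsupp.degree_eq_zero_iff, constantCoeff_eq]

variable {p : MvPolynomial (Fin n) k →ₐ[k] R} (hp : Function.Surjective p)

include hp in
theorem quotient_algHom_ext {f g : R →ₐ[k] T} (h : ∀ i, f (p (X i)) = g (p (X i))) : f = g :=
  (AlgHom.cancel_right hp).1 (MvPolynomial.algHom_ext h)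

include hp in
theorem poly_algHom_ext {f g : Polynomial R →ₐ[k] T}
    (h : ∀ i, f (.C (p (X i))) = g (.C (p (X i)))) (hX : f Polynomial.X = g Polynomial.X) :
    f = g :=
  Polynomial.algHom_ext' (quotient_algHom_ext hp h) hX

variable (hp₂ : RingHom.ker p ≤ idealOfVars (Fin n) k ^ 2)

/-- The algebra map out of a quotient of `A` sending the variables to elements whose pairwise
products are zero. -/
noncomputable def squareZeroLift (v : Fin n → T) (hv : ∀ i j, v i * v j = 0) : R →ₐ[k] T :=
  AlgHom.liftOfSurjective p hp (aeval v) (ker_le_ker_aeval hp₂ v hv)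

theorem squareZeroLift_X (v : Fin n → T) (hv : ∀ i j, v i * v j = 0) (i : Fin n) :
    squareZeroLift hp hp₂ v hv (p (X i)) = v i :=
  (AlgHom.liftOfSurjective_apply ..).trans (aeval_X v i)

/-- The extension of `squareZeroLift` to a polynomial ring. -/
noncomputable def polyLift (v : Fin n → T) (hv : ∀ i j, v i * v j = 0) (t : T) :
    Polynomial R →ₐ[k] T :=
  Polynomial.eval₂AlgHom (squareZeroLift hp hp₂ v hv) t fun _ => Commute.all _ _

theorem polyLift_C (v : Fin n → T) (hv : ∀ i j, v i * v j = 0) (t : T) (i : Fin n) :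
    polyLift hp hp₂ v hv t (.C (p (X i))) = v i :=
  (Polynomial.eval₂_C _ _).trans (squareZeroLift_X hp hp₂ v hv i)

theorem polyLift_X (v : Fin n → T) (hv : ∀ i j, v i * v j = 0) (t : T) :
    polyLift hp hp₂ v hv t Polynomial.X = t :=
  Polynomial.eval₂_X _ _

/-- The augmentation of a quotient of `A`. -/
noncomputable def quotientAugmentation : R →ₐ[k] k :=
  squareZeroLift hp hp₂ 0 fun _ _ => zero_mul 0

theorem quotientAugmentation_X (i : Fin n) : quotientAugmentation hp hp₂ (p (X i)) = 0 :=
  squareZeroLift_X ..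

theorem ker_quotientAugmentation :
    RingHom.ker (quotientAugmentation hp hp₂) =
      (idealOfVars (Fin n) k).map (p : MvPolynomial (Fin n) k →+* R) := by
  have h : RingHom.ker (aeval (0 : Fin n → k) : MvPolynomial (Fin n) k →ₐ[k] k) =
      (RingHom.ker (quotientAugmentation hp hp₂)).comap (p : MvPolynomial (Fin n) k →+* R) := by
    ext a
    rw [Ideal.mem_comap, RingHom.mem_ker, RingHom.mem_ker]
    exact Eq.congr_left (AlgHom.liftOfSurjective_apply ..).symm
  rw [← ker_aeval_zero, h]
  exact (Ideal.map_comap_of_surjective (p : MvPolynomial (Fin n) k →+* R) hp _).symm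

/-- The augmentation of a polynomial ring over a quotient of `A`. -/
noncomputable def polyAugmentation : Polynomial R →ₐ[k] k :=
  polyLift hp hp₂ 0 (fun _ _ => zero_mul 0) 0

theorem polyAugmentation_C (i : Fin n) : polyAugmentation hp hp₂ (.C (p (X i))) = 0 :=
  polyLift_C ..

theorem polyAugmentation_X : polyAugmentation hp hp₂ Polynomial.X = 0 :=
  polyLift_X ..

theorem exists_isNagataQuotient_X :
    ∃ f : Polynomial R →ₐ[k] R, IsNagataQuotient f (RingHom.ker (polyAugmentation hp hp₂))
      (RingHom.ker (quotientAugmentation hp hp₂)) Polynomial.X := by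
  let f : Polynomial R →ₐ[k] R := (Polynomial.aeval (0 : R)).restrictScalars k
  have hf : ∀ b, f b = b.coeff 0 := fun b => (Polynomial.coeff_zero_eq_aeval_zero b).symm
  refine ⟨f, .of_dualNumber (fun a => ⟨.C a, by simp [hf]⟩) _ _ (poly_algHom_ext hp ?_ ?_)
    (polyLift hp hp₂ 0 (fun _ _ => zero_mul 0) DualNumber.eps) (poly_algHom_ext hp ?_ ?_)
    (polyLift_X ..) ?_ ?_⟩
  · intro i
    simp [hf, quotientAugmentation_X, polyAugmentation_C]
  · simp [hf, polyAugmentation_X]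
  · intro i
    simp [polyAugmentation_C, polyLift_C]
  · simp [polyAugmentation_X, polyLift_X]
  · intro b hb
    rwa [mul_comm, Polynomial.monic_X.mul_left_eq_zero_iff] at hb
  · intro b
    rw [hf, Polynomial.X_dvd_iff]

/-- The endomorphism of `A` that raises the variables in `s` to the power `q`. -/
noncomputable def powVars (k : Type) [Field k] {n : ℕ} (q : ℕ) (s : Finset (Fin n)) :
    MvPolynomial (Fin n) k →ₐ[k] MvPolynomial (Fin n) k :=
  aeval fun i => if i ∈ s then X i ^ q else X i

theorem powVars_X (q : ℕ) (s : Finset (Fin n)) (i : Fin n) :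
    powVars k q s (X i) = if i ∈ s then X i ^ q else X i := aeval_X _ _

theorem exists_isNagataQuotient_pow_sub_C {q : ℕ} (hq : 0 < q) (j : Fin n)
    {p' : MvPolynomial (Fin n) k →ₐ[k] S} (hp' : Function.Surjective p')
    (hp₂' : RingHom.ker p' ≤ idealOfVars (Fin n) k ^ 2)
    (hker : RingHom.ker p' =
      (RingHom.ker p).map (powVars k q {j} : MvPolynomial (Fin n) k →+* MvPolynomial (Fin n) k)) :
    ∃ f : Polynomial R →ₐ[k] S, IsNagataQuotient f (RingHom.ker (polyAugmentation hp hp₂))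
      (RingHom.ker (quotientAugmentation hp' hp₂'))
      (Polynomial.X ^ q - Polynomial.C (p (X j))) := by
  set z : Polynomial R := Polynomial.X ^ q - Polynomial.C (p (X j)) with hz
  have hφ : RingHom.ker p ≤ RingHom.ker (p'.comp (powVars k q {j})) := fun a ha => by
    have h := Ideal.mem_map_of_mem
      (powVars k q {j} : MvPolynomial (Fin n) k →+* MvPolynomial (Fin n) k) ha
    rwa [← hker] at h
  let f : Polynomial R →ₐ[k] S :=
    Polynomial.eval₂AlgHom (AlgHom.liftOfSurjective p hp (p'.comp (powVars k q {j})) hφ)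
      (p' (X j)) fun _ => Commute.all _ _
  have hfC : ∀ a, f (.C (p a)) = p' (powVars k q {j} a) := fun a =>
    (Polynomial.eval₂_C _ _).trans
      (AlgHom.liftOfSurjective_apply p hp (p'.comp (powVars k q {j})) hφ a)
  have hfX : f Polynomial.X = p' (X j) := Polynomial.eval₂_X _ _
  have hfz : f z = 0 := by
    rw [hz, map_sub, map_pow, hfC, hfX, powVars_X, if_pos (Finset.mem_singleton_self j), map_pow,
      sub_self]
  let u : Fin n → Polynomial R := fun i => if i = j then Polynomial.X else .C (p (X i))
  have hf : Function.Surjective f := by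
    have h : f.comp (aeval u) = p' := by
      refine MvPolynomial.algHom_ext fun i => ?_
      by_cases hi : i = j <;> simp [u, hi, hfC, hfX, powVars_X]
    intro y
    obtain ⟨a, rfl⟩ := hp' y
    exact ⟨aeval u a, DFunLike.congr_fun h a⟩
  let π := Ideal.Quotient.mkₐ k (Ideal.span {z})
  have hπ : π Polynomial.X ^ q = π (.C (p (X j))) := by
    rw [← map_pow, ← sub_eq_zero, ← map_sub]
    exact Ideal.Quotient.eq_zero_iff_mem.2 (Ideal.mem_span_singleton_self z)
  have hw : ∀ a, aeval (π ∘ u) (powVars k q {j} a) = π (.C (p a)) := by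
    have h : (aeval (π ∘ u)).comp (powVars k q {j}) = (π.comp Polynomial.CAlgHom).comp p := by
      refine MvPolynomial.algHom_ext fun i => ?_
      by_cases hi : i = j <;> simp [u, hi, powVars_X, hπ]
    exact DFunLike.congr_fun h
  have hker' : RingHom.ker p' ≤ RingHom.ker (aeval (π ∘ u) : MvPolynomial (Fin n) k →ₐ[k] _) := by
    rw [hker, Ideal.map_le_iff_le_comap]
    intro a ha
    rw [RingHom.mem_ker] at ha
    exact (hw a).trans (by rw [ha, map_zero, map_zero])
  let g := AlgHom.liftOfSurjective p' hp' (aeval (π ∘ u)) hker'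
  have hgp : ∀ a, g (p' a) = aeval (π ∘ u) a := AlgHom.liftOfSurjective_apply _ _ _ _
  have hgf : g.comp f = π := by
    refine poly_algHom_ext hp (fun i => ?_) ?_
    · simp only [AlgHom.comp_apply, hfC, hgp, hw]
    · simp [hfX, hgp, u]
  refine ⟨f, .of_dualNumber hf _ _ (poly_algHom_ext hp ?_ ?_)
    (polyLift hp hp₂ (fun i => if i = j then -DualNumber.eps else 0) ?_ 0)
    (poly_algHom_ext hp ?_ ?_) ?_ ?_ ?_⟩
  · intro i
    by_cases hi : i = j <;>
      simp [hfC, hi, powVars_X, quotientAugmentation_X, polyAugmentation_C, hq.ne']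
  · simp [hfX, quotientAugmentation_X, polyAugmentation_X]
  · intro a b
    split_ifs <;> simp
  · intro i
    by_cases hi : i = j <;> simp [polyAugmentation_C, polyLift_C, hi]
  · simp [polyAugmentation_X, polyLift_X]
  · simp [hz, polyLift_X, polyLift_C, hq.ne']
  · intro b hb
    rwa [mul_comm, (Polynomial.monic_X_pow_sub_C _ hq.ne').mul_left_eq_zero_iff] at hb
  · intro b
    refine ⟨fun hb => ?_, ?_⟩
    · rw [← Ideal.mem_span_singleton, ← Ideal.Quotient.eq_zero_iff_mem]
      exact (DFunLike.congr_fun hgf b).symm.trans ((congrArg g hb).trans (map_zero g))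
    · rintro ⟨c, rfl⟩
      rw [map_mul, hfz, zero_mul]

end PolynomialQuotient

section Powers

variable {k : Type} [Field k] {n : ℕ}

theorem finite_quotient_ker {R : Type} [CommRing R] [Algebra k R] (e : R →ₐ[k] k) :
    Module.Finite k (R ⧸ RingHom.ker e) :=
  Module.Finite.of_injective (Ideal.kerLiftAlg e).toLinearMap (Ideal.kerLiftAlg_injective e)

theorem torLength_eq_of_ker_eq_map {R S : Type} [CommRing R] [Algebra k R] [CommRing S]
    [Algebra k S] {p : MvPolynomial (Fin n) k →ₐ[k] R} (hp : Function.Surjective p)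
    (hp₂ : RingHom.ker p ≤ idealOfVars (Fin n) k ^ 2)
    {p' : MvPolynomial (Fin n) k →ₐ[k] S} (hp' : Function.Surjective p')
    (hp₂' : RingHom.ker p' ≤ idealOfVars (Fin n) k ^ 2) {q : ℕ} (hq : 0 < q) (j : Fin n)
    (hker : RingHom.ker p' =
      (RingHom.ker p).map (powVars k q {j} : MvPolynomial (Fin n) k →+* MvPolynomial (Fin n) k))
    {J : Ideal R} (hJ : J = (idealOfVars (Fin n) k).map (p : MvPolynomial (Fin n) k →+* R))
    {J' : Ideal S} (hJ' : J' = (idealOfVars (Fin n) k).map (p' : MvPolynomial (Fin n) k →+* S))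
    (i : ℕ) : torLength k J (R ⧸ J) i = torLength k J' (S ⧸ J') i := by
  have : IsNoetherianRing R :=
    isNoetherianRing_of_surjective _ R (p : MvPolynomial (Fin n) k →+* R) hp
  have : Module.Finite k (Polynomial R ⧸ RingHom.ker (polyAugmentation hp hp₂)) :=
    finite_quotient_ker _
  obtain ⟨f, hf⟩ := exists_isNagataQuotient_X hp hp₂
  obtain ⟨g, hg⟩ := exists_isNagataQuotient_pow_sub_C hp hp₂ hq j hp' hp₂' hker
  rw [← hJ.trans (ker_quotientAugmentation hp hp₂).symm] at hf
  rw [← hJ'.trans (ker_quotientAugmentation hp' hp₂').symm] at hg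
  exact torLength_residue_eq hf hg i

theorem map_powVars_le {q : ℕ} (hq : 0 < q) (s : Finset (Fin n))
    {I : Ideal (MvPolynomial (Fin n) k)} (hI : I ≤ idealOfVars (Fin n) k ^ 2) :
    I.map (powVars k q s : MvPolynomial (Fin n) k →+* MvPolynomial (Fin n) k) ≤
      idealOfVars (Fin n) k ^ 2 := by
  refine (Ideal.map_mono hI).trans ?_
  rw [Ideal.map_pow]
  refine Ideal.pow_right_mono ?_ 2
  rw [idealOfVars, Ideal.map_span, Ideal.span_le]
  rintro _ ⟨_, ⟨i, rfl⟩, rfl⟩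
  have hX : (X i : MvPolynomial (Fin n) k) ∈ idealOfVars (Fin n) k :=
    Ideal.subset_span ⟨i, rfl⟩
  change powVars k q s (X i) ∈ idealOfVars (Fin n) k
  rw [powVars_X]
  split_ifs
  · exact Ideal.pow_mem_of_mem _ hX q hq
  · exact hX

theorem torLength_resMax_map_powVars_singleton {q : ℕ} (hq : 0 < q) (j : Fin n)
    {I : Ideal (MvPolynomial (Fin n) k)} (hI : I ≤ idealOfVars (Fin n) k ^ 2)
    {I' : Ideal (MvPolynomial (Fin n) k)}
    (hI' : I' = I.map (powVars k q {j} : MvPolynomial (Fin n) k →+* MvPolynomial (Fin n) k))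
    (i : ℕ) :
    torLength k (resMax k n I) ((MvPolynomial (Fin n) k ⧸ I) ⧸ resMax k n I) i =
      torLength k (resMax k n I') ((MvPolynomial (Fin n) k ⧸ I') ⧸ resMax k n I') i := by
  have hker : ∀ I : Ideal (MvPolynomial (Fin n) k),
      RingHom.ker (Ideal.Quotient.mkₐ k I) = I := fun I =>
    Ideal.Quotient.mkₐ_ker k I
  refine torLength_eq_of_ker_eq_map (p := Ideal.Quotient.mkₐ k I)
    (Ideal.Quotient.mkₐ_surjective k I)
    ?_ (p' := Ideal.Quotient.mkₐ k I') (Ideal.Quotient.mkₐ_surjective k I') ?_ hq j ?_ rfl rfl i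
  · rwa [hker]
  · rw [hker, hI']
    exact map_powVars_le hq _ hI
  · rw [hker, hker, hI']

theorem finite_quotient_resMax {I : Ideal (MvPolynomial (Fin n) k)}
    (hI : I ≤ idealOfVars (Fin n) k ^ 2) :
    Module.Finite k ((MvPolynomial (Fin n) k ⧸ I) ⧸ resMax k n I) := by
  have hker : RingHom.ker (Ideal.Quotient.mkₐ k I) = I := Ideal.Quotient.mkₐ_ker k I
  have h := ker_quotientAugmentation (Ideal.Quotient.mkₐ_surjective k I) (hker.trans_le hI)
  have h' : resMax k n I = _ := h.symm
  rw [h']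
  exact finite_quotient_ker _

theorem powVars_insert {q : ℕ} {j : Fin n} {s : Finset (Fin n)} (hj : j ∉ s) :
    powVars k q (insert j s) = (powVars k q {j}).comp (powVars k q s) := by
  refine MvPolynomial.algHom_ext fun i => ?_
  rw [AlgHom.comp_apply, powVars_X, powVars_X]
  by_cases hi : i = j
  · subst hi
    simp [hj, powVars_X]
  · by_cases hs : i ∈ s <;> simp [hi, hs, powVars_X]

theorem torLength_resMax_map_powVars {q : ℕ} (hq : 0 < q) (s : Finset (Fin n))
    {I : Ideal (MvPolynomial (Fin n) k)} (hI : I ≤ idealOfVars (Fin n) k ^ 2)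
    {I' : Ideal (MvPolynomial (Fin n) k)}
    (hI' : I' = I.map (powVars k q s : MvPolynomial (Fin n) k →+* MvPolynomial (Fin n) k))
    (i : ℕ) :
    torLength k (resMax k n I) ((MvPolynomial (Fin n) k ⧸ I) ⧸ resMax k n I) i =
      torLength k (resMax k n I') ((MvPolynomial (Fin n) k ⧸ I') ⧸ resMax k n I') i := by
  induction s using Finset.induction_on generalizing I' with
  | empty =>
    have h : powVars k q (∅ : Finset (Fin n)) = AlgHom.id k _ :=
      MvPolynomial.algHom_ext fun i => by simp [powVars_X]
    rw [h] at hI'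
    obtain rfl : I' = I := hI'.trans (Ideal.map_id I)
    rfl
  | insert j s hj ih =>
    rw [ih rfl]
    refine torLength_resMax_map_powVars_singleton hq j (map_powVars_le hq s hI) ?_ i
    rw [hI', powVars_insert hj, Ideal.map_map]
    rfl

theorem powVars_univ_monomial (q : ℕ) (a : Fin n →₀ ℕ) :
    powVars k q Finset.univ (monomial a 1) = monomial a 1 ^ q := by
  rw [monomial_eq, C_1, one_mul]
  simp only [Finsupp.prod, map_prod, map_pow, powVars_X, Finset.mem_univ, if_true,
    ← Finset.prod_pow, pow_right_comm]

theorem nonempty_torVS_equiv {R S : Type} [CommRing R] [Algebra k R] [CommRing S] [Algebra k S]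
    {J : Ideal R} {J' : Ideal S} {i : ℕ}
    (hR : torLength k J (R ⧸ J) i ≠ ⊤) (h : torLength k J (R ⧸ J) i = torLength k J' (S ⧸ J') i) :
    Nonempty (TorVS k R J i ≃ₗ[k] TorVS k S J' i) := by
  have h₁ : torLength k J (R ⧸ J) i = Module.length k (TorVS k R J i) := rfl
  have h₂ : torLength k J' (S ⧸ J') i = Module.length k (TorVS k S J' i) := rfl
  have hS := h ▸ hR
  rw [h₁, h₂] at h
  rw [h₁, Module.length_ne_top_iff] at hR
  rw [h₂, Module.length_ne_top_iff] at hS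
  have : Module.Finite k (TorVS k R J i) :=
    have := (isFiniteLength_iff_isNoetherian_isArtinian.1 hR).1; inferInstance
  have : Module.Finite k (TorVS k S J' i) :=
    have := (isFiniteLength_iff_isNoetherian_isArtinian.1 hS).1; inferInstance
  rw [Module.length_eq_finrank, Module.length_eq_finrank, Nat.cast_inj] at h
  exact FiniteDimensional.nonempty_linearEquiv_of_finrank_eq h

end Powers

/-- Step (a) in Theorem 2.3: for a squarefree monomial ideal `I ⊆ 𝔪_A²` and `I_q`
generated by the `q`-th powers of its minimal monomial generators, there is an
isomorphism of `k`-vector spaces `Tor_i^{A/I}(k,k) ≅ Tor_i^{A/I_q}(k,k)` for all `i`. -/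
theorem tor_iso_of_powers_squarefree (k : Type) [Field k] (n t q : ℕ) (hq : 0 < q)
    (m : Fin t → (Fin n →₀ ℕ))
    (hsf : ∀ j i, m j i ≤ 1)
    (hmin : ∀ j j' : Fin t, m j ≤ m j' → j = j')
    (I Iq : Ideal (MvPolynomial (Fin n) k))
    (hI : I = Ideal.span (Set.range fun j => monomial (m j) (1 : k)))
    (hIq : Iq = Ideal.span (Set.range fun j => (monomial (m j) (1 : k)) ^ q))
    (hI2 : I ≤ (Ideal.span (Set.range (X : Fin n → MvPolynomial (Fin n) k))) ^ 2) :
    ∀ i : ℕ,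
      Nonempty ((TorVS k (MvPolynomial (Fin n) k ⧸ I) (resMax k n I) i) ≃ₗ[k]
        (TorVS k (MvPolynomial (Fin n) k ⧸ Iq) (resMax k n Iq) i)) := by
  intro i
  have hmap : Iq =
      I.map (powVars k q (Finset.univ : Finset (Fin n)) :
        MvPolynomial (Fin n) k →+* MvPolynomial (Fin n) k) := by
    rw [hI, hIq, Ideal.map_span, ← Set.range_comp]
    exact congrArg _ (congrArg _ (funext fun j => (powVars_univ_monomial q (m j)).symm))
  have : Module.Finite k ((MvPolynomial (Fin n) k ⧸ I) ⧸ resMax k n I) :=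
    finite_quotient_resMax hI2
  exact nonempty_torVS_equiv (torLength_ne_top k _ _ i)
    (torLength_resMax_map_powVars hq Finset.univ hI2 hmap i)
end

section
/- Let m_1,…,m_t be distinct monomials in A = k[x_1,…,x_n], each of degree exactly 2, satisfying the minimal Taylor resolution condition. Then there exists a partition P_1,…,P_r of {1,…,t} such that gcd(m_a, m_b) is a unit whenever a and b lie in different blocks, and for every block P_i containing at least two elements there is a variable x_j dividing m_a for every a ∈ P_i. (Consequently A/(m_1,…,m_t) is a tensor product over k of a complete intersection and trivially Golod rings.) -/
open MvPolynomial

/-- Monomials (given by their exponent vectors) satisfy the minimal Taylor resolution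
condition if for every subset `S` of indices and every `j ∈ S`, the lcm of the monomials
indexed by `S` differs from the lcm of the monomials indexed by `S \ {j}`. -/
def MinimalTaylor {n t : ℕ} (m : Fin t → (Fin n →₀ ℕ)) : Prop :=
  ∀ S : Finset (Fin t), ∀ j ∈ S, S.sup m ≠ (S.erase j).sup m

/-- Each member of a family satisfying the minimal Taylor condition has a variable in which its
exponent strictly dominates that of every other member. -/
theorem MinimalTaylor.exists_forall_lt {n t : ℕ} {m : Fin t → (Fin n →₀ ℕ)}
    (h : MinimalTaylor m) (j : Fin t) : ∃ x, ∀ i, i ≠ j → m i x < m j x := by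
  by_contra! hc
  refine h Finset.univ j (Finset.mem_univ j) (le_antisymm (Finset.sup_le fun i _ => ?_)
    (Finset.sup_mono (Finset.erase_subset _ _)))
  by_cases hij : i = j
  · subst hij
    intro x
    obtain ⟨l, hl, hlx⟩ := hc x
    exact hlx.trans (Finset.le_sup (f := m) (Finset.mem_erase.2 ⟨hl, Finset.mem_univ l⟩) x)
  · exact Finset.le_sup (Finset.mem_erase.2 ⟨hij, Finset.mem_univ i⟩)

/-- An exponent vector of degree two is the sum of a given variable in its support and another
variable. -/
theorem Finsupp.exists_eq_single_add_single_of_sum_eq_two {σ : Type*} {f : σ →₀ ℕ} {x : σ}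
    (hf : f.sum (fun _ e => e) = 2) (hx : 0 < f x) :
    ∃ y, f = Finsupp.single x 1 + Finsupp.single y 1 := by
  have hle : Finsupp.single x 1 ≤ f := Finsupp.single_le_iff.2 hx
  obtain ⟨g, rfl⟩ := exists_add_of_le hle
  have hg : g.degree = 1 := by
    have : (Finsupp.single x 1 + g).degree = 2 := hf
    rw [map_add, Finsupp.degree_single] at this
    omega
  obtain ⟨y, rfl⟩ := (Finsupp.sum_eq_one_iff g).1 hg
  exact ⟨y, rfl⟩

/-- Distinct variables are relatively prime. -/
theorem MvPolynomial.isRelPrime_X_of_ne {σ k : Type*} [Field k] {x y : σ} (h : x ≠ y) :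
    IsRelPrime (X x : MvPolynomial σ k) (X y) :=
  (X_prime (i := x)).irreducible.isRelPrime_iff_not_dvd.2 fun hd => h (X_dvd_X.1 hd)

/-- Theorem 4.2: if `m_1,…,m_t` are distinct quadratic monomials with minimal Taylor
resolution, then the index set `{1,…,t}` has a partition (the fibers of `c`) such that
monomials in different blocks are coprime, and each block with at least two elements has a
common variable dividing all its monomials. -/
theorem partition_of_quadratic_minimal_taylor (k : Type) [Field k] (n t : ℕ)
    (m : Fin t → (Fin n →₀ ℕ))
    (hdist : Function.Injective m)
    (hdeg : ∀ j, (m j).sum (fun _ e => e) = 2)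
    (hmt : MinimalTaylor m) :
    ∃ (r : ℕ) (c : Fin t → Fin r), Function.Surjective c ∧
      (∀ a b : Fin t, c a ≠ c b → ∀ d : MvPolynomial (Fin n) k,
          d ∣ monomial (m a) (1 : k) → d ∣ monomial (m b) (1 : k) → IsUnit d) ∧
      (∀ i : Fin r, 2 ≤ (Finset.univ.filter (fun a => c a = i)).card →
          ∃ x : Fin n, ∀ a : Fin t, c a = i →
            (X x : MvPolynomial (Fin n) k) ∣ monomial (m a) (1 : k)) := by
  have hpq : ∀ j, ∃ p q, m j = Finsupp.single p 1 + Finsupp.single q 1 ∧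
      ∀ i, i ≠ j → m i p < m j p := by
    intro j
    obtain ⟨x, hx⟩ := hmt.exists_forall_lt j
    by_cases hpos : 0 < m j x
    · obtain ⟨y, hy⟩ := Finsupp.exists_eq_single_add_single_of_sum_eq_two (hdeg j) hpos
      exact ⟨x, y, hy, hx⟩
    · have hne : m j ≠ 0 := fun h0 => by simpa [h0] using hdeg j
      obtain ⟨z, hz⟩ := Finsupp.ne_iff.1 hne
      obtain ⟨y, hy⟩ := Finsupp.exists_eq_single_add_single_of_sum_eq_two (hdeg j)
        (Nat.pos_of_ne_zero hz)
      exact ⟨z, y, hy, fun i hi => absurd (hx i hi) (by omega)⟩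
  choose p q hm hlt using hpq
  have hmon : ∀ j, (monomial (m j) (1 : k)) = X (p j) * X (q j) := by
    intro j
    rw [hm j, X, X, monomial_mul, one_mul]
  have hne : ∀ a b, q a ≠ q b → p a ≠ p b ∧ p a ≠ q b := by
    intro a b hab
    have hba : b ≠ a := fun h => hab (by rw [h])
    have h1 := hlt a b hba
    have h2 := hlt b a hba.symm
    simp only [hm, Finsupp.add_apply, Finsupp.single_apply] at h1 h2
    grind
  let e := Fintype.equivFin (Set.range q)
  refine ⟨_, fun a => e (Set.rangeFactorization q a),
    e.surjective.comp Set.rangeFactorization_surjective, ?_, ?_⟩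
  · intro a b hab d hda hdb
    have hq : q a ≠ q b := fun h => hab (congrArg e (Subtype.ext h))
    rw [hmon] at hda hdb
    obtain ⟨hpp, hpq⟩ := hne a b hq
    have hqp := (hne b a hq.symm).2.symm
    exact ((isRelPrime_X_of_ne hpp).mul_right (isRelPrime_X_of_ne hpq)).mul_left
      ((isRelPrime_X_of_ne hqp).mul_right (isRelPrime_X_of_ne hq)) hda hdb
  · intro i _
    refine ⟨(e.symm i : Fin n), fun a ha => ?_⟩
    rw [hmon, ← ha, Equiv.symm_apply_apply]
    exact dvd_mul_left _ _
end
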